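/- arXiv:2201.06671 — 5 statements merged into one kernel-verified Lean document; each statement's English description precedes it below -/
import Mathlib

section
/- The explicit mutual coherence function μ₂(z,x,y) := F(τ/τ_s) · exp( −|y|²/(4ℓ_s²) − (σ_m² k₀² ℓ_m z/4)·(1 − G(τ/τ_m) C(y/ℓ_m)) ), which does not depend on x, satisfies for all z ≥ 0, x ∈ ℝ², y ∈ ℝ² the second-moment equation ∂μ₂/∂z = (i/k₀) Σ_{j=1,2} ∂²μ₂/∂x_j∂y_j + (k₀² σ_m² ℓ_m/4)·( G(τ/τ_m) C(y/ℓ_m) − 1 )·μ₂, together with the initial condition μ₂(0,x,y) = F(τ/τ_s) exp(−|y|²/(4ℓ_s²)). -/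
open MeasureTheory Complex Topology Filter

/-- The explicit mutual coherence function
μ₂(z,x,y) = F(τ/τ_s) exp(−|y|²/(4ℓ_s²) − (σ_m²k₀²ℓ_m z/4)(1 − G(τ/τ_m)C(y/ℓ_m)))
satisfies the second-moment equation and the initial condition. -/
theorem scintillation_second_moment_equation
    (k₀ σm ℓm ℓs τs τm τ : ℝ)
    (hk : 0 < k₀) (hσ : 0 < σm) (hℓm : 0 < ℓm) (hℓs : 0 < ℓs)
    (hτs : 0 < τs) (hτm : 0 < τm)
    (F G : ℝ → ℝ) (C : EuclideanSpace ℝ (Fin 2) → ℝ)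
    (μ₂ : ℝ → EuclideanSpace ℝ (Fin 2) → EuclideanSpace ℝ (Fin 2) → ℂ)
    (hμ : ∀ (z : ℝ) (x y : EuclideanSpace ℝ (Fin 2)),
      μ₂ z x y = ((F (τ/τs) : ℝ) : ℂ) *
        Complex.exp ( -(((‖y‖^2 / (4*ℓs^2)) : ℝ) : ℂ)
          - (((σm^2 * k₀^2 * ℓm * z / 4) : ℝ) : ℂ)
            * (1 - ((G (τ/τm) : ℝ) : ℂ) * ((C (ℓm⁻¹ • y) : ℝ) : ℂ)))) :
    (∀ z : ℝ, 0 ≤ z → ∀ x y : EuclideanSpace ℝ (Fin 2),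
      deriv (fun z' => μ₂ z' x y) z =
        (Complex.I / (k₀ : ℂ)) *
          (∑ j : Fin 2,
            fderiv ℝ
              (fun y' => fderiv ℝ (fun x' => μ₂ z x' y') x (EuclideanSpace.single j (1:ℝ)))
              y (EuclideanSpace.single j (1:ℝ)))
        + (((k₀^2 * σm^2 * ℓm / 4) : ℝ) : ℂ)
            * (((G (τ/τm) * C (ℓm⁻¹ • y) - 1) : ℝ) : ℂ) * μ₂ z x y)
    ∧ (∀ x y : EuclideanSpace ℝ (Fin 2),
        μ₂ 0 x y = ((F (τ/τs) : ℝ) : ℂ) *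
          Complex.exp (-(((‖y‖^2 / (4*ℓs^2)) : ℝ) : ℂ))) := by
  refine ⟨fun z _ x y => ?_, fun x y => by simp [hμ]⟩
  have hconst : ∀ y', (fun x' => μ₂ z x' y') = fun _ => μ₂ z 0 y' := fun y' =>
    funext fun x' => by rw [hμ, hμ]
  have hlin : HasDerivAt
      (fun z' : ℝ => -(((‖y‖^2 / (4*ℓs^2)) : ℝ) : ℂ) - (((σm^2 * k₀^2 * ℓm * z' / 4) : ℝ) : ℂ)
        * (1 - ((G (τ/τm) : ℝ) : ℂ) * ((C (ℓm⁻¹ • y) : ℝ) : ℂ)))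
      (-((((σm^2 * k₀^2 * ℓm * 1 / 4) : ℝ) : ℂ)
        * (1 - ((G (τ/τm) : ℝ) : ℂ) * ((C (ℓm⁻¹ • y) : ℝ) : ℂ)))) z :=
    (((((hasDerivAt_id z).const_mul (σm^2 * k₀^2 * ℓm)).div_const 4).ofReal_comp).mul_const
      _).const_sub _
  have hderiv := (hlin.cexp).const_mul ((F (τ/τs) : ℝ) : ℂ)
  rw [show (fun z' => μ₂ z' x y) = _ from funext fun z' => hμ z' x y, hderiv.deriv]
  simp only [hconst, fderiv_fun_const, Pi.zero_apply, _root_.zero_apply,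
    Finset.sum_const_zero, mul_zero, zero_add, hμ z x y]
  push_cast
  ring
end

section
/- Let μ₂(z,y) := exp( −|y|²/(4ℓ_s²) − (σ_m² k₀² ℓ_m z/4)·(1 − C(y/ℓ_m)) ) for fixed z > 0. If C satisfies C(χ) = 1 − c₂|χ|² + o(|χ|²) as χ → 0 (i.e., (1 − C(χ) − c₂|χ|²)/|χ|² → 0 as χ → 0), then lim_{y → 0, y ≠ 0} ( −log μ₂(z,y) ) / |y|² = (1/4)·( ℓ_s^{−2} + c₂ σ_m² k₀² z / ℓ_m ). In other words, the correlation radius ρ_c(z) of the wave field satisfies ρ_c^{−2}(z) = ℓ_s^{−2} + c₂ σ_m² k₀² z / ℓ_m. -/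
open MeasureTheory Topology Filter

/-- with C(χ) = 1 − c₂|χ|² + o(|χ|²), the mutual coherence function
μ₂(z,y) = exp(−|y|²/(4ℓ_s²) − (σ_m²k₀²ℓ_m z/4)(1 − C(y/ℓ_m))) satisfies
lim_{y→0, y≠0} (−log μ₂(z,y))/|y|² = (1/4)(ℓ_s⁻² + c₂σ_m²k₀²z/ℓ_m), i.e.
ρ_c⁻²(z) = ℓ_s⁻² + c₂σ_m²k₀²z/ℓ_m. -/
theorem correlation_radius_of_wave_field
    (k₀ σm ℓm ℓs c₂ z : ℝ)
    (hk : 0 < k₀) (hσ : 0 < σm) (hℓm : 0 < ℓm) (hℓs : 0 < ℓs)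
    (hc₂ : 0 < c₂) (hz : 0 < z)
    (C : EuclideanSpace ℝ (Fin 2) → ℝ) (hC0 : C 0 = 1)
    (hCexp : Filter.Tendsto
      (fun χ : EuclideanSpace ℝ (Fin 2) => (1 - C χ - c₂ * ‖χ‖^2) / ‖χ‖^2)
      (𝓝[≠] 0) (𝓝 0))
    (μ₂ : EuclideanSpace ℝ (Fin 2) → ℝ)
    (hμ : ∀ y, μ₂ y = Real.exp (-(‖y‖^2 / (4*ℓs^2))
      - (σm^2 * k₀^2 * ℓm * z / 4) * (1 - C (ℓm⁻¹ • y)))) :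
    Filter.Tendsto (fun y : EuclideanSpace ℝ (Fin 2) => (-Real.log (μ₂ y)) / ‖y‖^2)
      (𝓝[≠] 0) (𝓝 ((1/4) * (1/ℓs^2 + c₂ * σm^2 * k₀^2 * z / ℓm))) := by
  have hscale : Tendsto (fun y : EuclideanSpace ℝ (Fin 2) => ℓm⁻¹ • y) (𝓝[≠] 0) (𝓝[≠] 0) := by
    refine tendsto_nhdsWithin_iff.2 ⟨?_, ?_⟩
    · have hcont : Continuous fun y : EuclideanSpace ℝ (Fin 2) => ℓm⁻¹ • y := by fun_prop
      simpa using (hcont.tendsto 0).mono_left nhdsWithin_le_nhds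
    · filter_upwards [self_mem_nhdsWithin] with y hy
      exact smul_ne_zero (inv_ne_zero hℓm.ne') hy
  have hlim := ((hCexp.comp hscale).const_mul (σm^2 * k₀^2 * z / (4 * ℓm))).const_add
    ((1/4) * (1/ℓs^2 + c₂ * σm^2 * k₀^2 * z / ℓm))
  rw [mul_zero, add_zero] at hlim
  refine hlim.congr' ?_
  filter_upwards [self_mem_nhdsWithin] with y hy
  have hy' : ‖y‖ ≠ 0 := norm_ne_zero_iff.2 hy
  rw [hμ, Real.log_exp]
  simp only [Function.comp_apply, norm_smul, norm_inv, Real.norm_of_nonneg hℓm.le]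
  field_simp
  ring
end

section
/- Let D > 0 and k₀ > 0, and define for z > 0 and ξ, ζ ∈ ℝ² the ℂ-valued function H(z, ξ, ζ) := (1/(4π D z)) · exp( − i z (ξ·ζ)/(2k₀) − D z³ |ζ|² /(12 k₀²) − |ξ|²/(4 D z) ). Then H satisfies the partial differential equation ∂H/∂z + (i/k₀)(ξ·ζ) H = D Δ_ξ H on (0,∞) × ℝ² × ℝ², where Δ_ξ is the Laplacian in the two components of ξ and ξ·ζ is the Euclidean inner product on ℝ². -/
open MeasureTheory Real RealInnerProductSpace

section GaussianDerivatives

variable {E : Type*} [NormedAddCommGroup E] [InnerProductSpace ℝ E]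

lemma hasFDerivAt_const_mul_inner_left (a : ℂ) (ζ ξ : E) :
    HasFDerivAt (fun x : E => a * ((⟪x, ζ⟫ : ℝ) : ℂ))
      (a • Complex.ofRealCLM.comp (innerSL ℝ ζ)) ξ := by
  have h := (Complex.ofRealCLM.comp (innerSL ℝ ζ)).hasFDerivAt (x := ξ)
  simpa [real_inner_comm] using h.const_mul a

lemma hasFDerivAt_const_mul_norm_sq (b : ℂ) (ξ : E) :
    HasFDerivAt (fun x : E => b * ((‖x‖ ^ 2 : ℝ) : ℂ))
      (b • Complex.ofRealCLM.comp (2 • innerSL ℝ ξ)) ξ :=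
  (Complex.ofRealCLM.hasFDerivAt.comp ξ
    (hasStrictFDerivAt_norm_sq ξ).hasFDerivAt).const_mul b

lemma hasFDerivAt_gaussian (C a b c : ℂ) (ζ ξ : E) :
    HasFDerivAt
      (fun x : E => C * Complex.exp (a * ((⟪x, ζ⟫ : ℝ) : ℂ) + c + b * ((‖x‖ ^ 2 : ℝ) : ℂ)))
      (C • Complex.exp (a * ((⟪ξ, ζ⟫ : ℝ) : ℂ) + c + b * ((‖ξ‖ ^ 2 : ℝ) : ℂ)) •
        (a • Complex.ofRealCLM.comp (innerSL ℝ ζ) +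
          b • Complex.ofRealCLM.comp (2 • innerSL ℝ ξ))) ξ :=
  ((((hasFDerivAt_const_mul_inner_left a ζ ξ).add_const c).add
    (hasFDerivAt_const_mul_norm_sq b ξ)).cexp).const_mul C

lemma fderiv_gaussian_apply (C a b c : ℂ) (ζ ξ v : E) :
    fderiv ℝ
      (fun x : E => C * Complex.exp (a * ((⟪x, ζ⟫ : ℝ) : ℂ) + c + b * ((‖x‖ ^ 2 : ℝ) : ℂ))) ξ v =
      C * Complex.exp (a * ((⟪ξ, ζ⟫ : ℝ) : ℂ) + c + b * ((‖ξ‖ ^ 2 : ℝ) : ℂ)) *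
        (a * ((⟪ζ, v⟫ : ℝ) : ℂ) + 2 * b * ((⟪ξ, v⟫ : ℝ) : ℂ)) := by
  rw [(hasFDerivAt_gaussian C a b c ζ ξ).fderiv]
  simp
  ring

lemma fderiv_fderiv_gaussian_apply (C a b c : ℂ) (ζ ξ v : E) :
    fderiv ℝ (fun y : E => fderiv ℝ
      (fun x : E => C * Complex.exp (a * ((⟪x, ζ⟫ : ℝ) : ℂ) + c + b * ((‖x‖ ^ 2 : ℝ) : ℂ))) y v)
      ξ v =
      C * Complex.exp (a * ((⟪ξ, ζ⟫ : ℝ) : ℂ) + c + b * ((‖ξ‖ ^ 2 : ℝ) : ℂ)) *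
        ((a * ((⟪ζ, v⟫ : ℝ) : ℂ) + 2 * b * ((⟪ξ, v⟫ : ℝ) : ℂ)) ^ 2 +
          2 * b * ((‖v‖ ^ 2 : ℝ) : ℂ)) := by
  simp only [fderiv_gaussian_apply]
  rw [((hasFDerivAt_gaussian C a b c ζ ξ).fun_mul
    ((hasFDerivAt_const_mul_inner_left (2 * b) v ξ).const_add
      (a * ((⟪ζ, v⟫ : ℝ) : ℂ)))).fderiv]
  simp
  ring

end GaussianDerivatives

/-- the function
H(z,ξ,ζ) = (1/(4πDz)) exp(−iz(ξ·ζ)/(2k₀) − Dz³|ζ|²/(12k₀²) − |ξ|²/(4Dz))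
satisfies ∂H/∂z + (i/k₀)(ξ·ζ)H = D Δ_ξ H on (0,∞)×ℝ²×ℝ². -/
theorem spot_dancing_fourth_moment_pde
    (D k₀ : ℝ) (hD : 0 < D) (hk : 0 < k₀)
    (H : ℝ → EuclideanSpace ℝ (Fin 2) → EuclideanSpace ℝ (Fin 2) → ℂ)
    (hH : ∀ (z : ℝ) (ξ ζ : EuclideanSpace ℝ (Fin 2)),
      H z ξ ζ = (((1 / (4 * Real.pi * D * z)) : ℝ) : ℂ) *
        Complex.exp ( -Complex.I * (z : ℂ) * ((⟪ξ, ζ⟫ : ℝ) : ℂ) / (2 * (k₀ : ℂ))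
          - (((D * z^3 * ‖ζ‖^2 / (12 * k₀^2)) : ℝ) : ℂ)
          - (((‖ξ‖^2 / (4 * D * z)) : ℝ) : ℂ))) :
    ∀ z : ℝ, 0 < z → ∀ ξ ζ : EuclideanSpace ℝ (Fin 2),
      deriv (fun z' => H z' ξ ζ) z
        + (Complex.I / (k₀ : ℂ)) * ((⟪ξ, ζ⟫ : ℝ) : ℂ) * H z ξ ζ
      = (D : ℂ) * ∑ j : Fin 2,
          fderiv ℝ (fun ξ' => fderiv ℝ (fun ξ'' => H z ξ'' ζ) ξ' (EuclideanSpace.single j (1:ℝ)))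
            ξ (EuclideanSpace.single j (1:ℝ)) := by
  intro z hz ξ ζ
  have hzC : (z : ℂ) ≠ 0 := by exact_mod_cast hz.ne'
  have hDC : (D : ℂ) ≠ 0 := by exact_mod_cast hD.ne'
  have hkC : (k₀ : ℂ) ≠ 0 := by exact_mod_cast hk.ne'
  have hξ : (fun x => H z x ζ) = fun x => (1 / (4 * Real.pi * D * z) : ℂ) *
      Complex.exp ((-Complex.I * z / (2 * k₀)) * ((⟪x, ζ⟫ : ℝ) : ℂ) +
        -(D * z ^ 3 * ‖ζ‖ ^ 2 / (12 * k₀ ^ 2)) + (-1 / (4 * D * z)) * ((‖x‖ ^ 2 : ℝ) : ℂ)) := by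
    funext x
    rw [hH]
    push_cast
    congr 2
    ring
  have hval := congrFun hξ ξ
  have hdz : HasDerivAt (fun z' => H z' ξ ζ)
      (H z ξ ζ * (-1 / z - Complex.I * ((⟪ξ, ζ⟫ : ℝ) : ℂ) / (2 * k₀)
        - D * z ^ 2 * ‖ζ‖ ^ 2 / (4 * k₀ ^ 2) + ‖ξ‖ ^ 2 / (4 * D * z ^ 2))) z := by
    have hid : HasDerivAt (fun w : ℝ => (w : ℂ)) 1 z := Complex.ofRealCLM.hasDerivAt
    have hinv := hid.inv hzC
    have hphase := ((hid.const_mul (-Complex.I * ((⟪ξ, ζ⟫ : ℝ) : ℂ) / (2 * k₀))).sub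
      ((hid.pow 3).const_mul ((D : ℂ) * ‖ζ‖ ^ 2 / (12 * k₀ ^ 2)))).sub
      (hinv.const_mul ((‖ξ‖ : ℂ) ^ 2 / (4 * D)))
    have hfun : (fun z' => H z' ξ ζ) = fun w : ℝ => (1 / (4 * Real.pi * D) : ℂ) * (w : ℂ)⁻¹ *
        Complex.exp ((-Complex.I * ((⟪ξ, ζ⟫ : ℝ) : ℂ) / (2 * k₀)) * w
          - ((D : ℂ) * ‖ζ‖ ^ 2 / (12 * k₀ ^ 2)) * (w : ℂ) ^ 3
          - ((‖ξ‖ : ℂ) ^ 2 / (4 * D)) * (w : ℂ)⁻¹) := by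
      funext w
      rw [hH]
      push_cast
      congr 1
      · ring
      · congr 1
        ring
    rw [congrFun hfun z, hfun]
    refine ((hinv.const_mul (1 / (4 * Real.pi * D) : ℂ)).mul hphase.cexp).congr_deriv ?_
    simp only [Pi.sub_apply, Pi.pow_apply, Pi.inv_apply]
    field_simp
    ring
  have hinner : ((⟪ξ, ζ⟫ : ℝ) : ℂ) = ξ 0 * ζ 0 + ξ 1 * ζ 1 := by
    simp [PiLp.inner_apply, Fin.sum_univ_two, mul_comm]
  have hnorm (x : EuclideanSpace ℝ (Fin 2)) : (‖x‖ : ℂ) ^ 2 = x 0 ^ 2 + x 1 ^ 2 := by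
    exact_mod_cast by simp [EuclideanSpace.norm_sq_eq, Fin.sum_univ_two]
  rw [hdz.deriv, hξ]
  simp only [fderiv_fderiv_gaussian_apply]
  rw [← hval]
  simp only [Fin.sum_univ_two, hnorm, hinner, EuclideanSpace.inner_single_right,
    PiLp.norm_single]
  simp
  field_simp
  ring_nf
  simp only [Complex.I_sq]
  ring
end

section
/- Let D > 0, L > 0, k₀ > 0, ℓ_s > 0. Define H(L, ξ, ζ) := (1/(4π D L)) · exp( − i L (ξ·ζ)/(2k₀) − D L³ |ζ|² /(12 k₀²) − |ξ|²/(4 D L) ) and the Gaussian density φ_{1/ℓ_s}(ζ) := (ℓ_s²/(2π)) exp(−ℓ_s² |ζ|²/2). Then ∫_{ℝ²} ∫_{ℝ²} H(L, ξ, ζ) φ_{1/ℓ_s}(ζ) dξ dζ = 1 / ( 1 + 2 D L³ / (3 k₀² ℓ_s²) ). In particular, with D = c₂ (1 − g_τ) σ_m² k₀² / (2 ℓ_m), this integral equals 1 / ( 1 + c₂ (1 − g_τ) σ_m² L³ / (3 ℓ_m ℓ_s²) ), the relative intensity covariance in the small source correlation radius regime. -/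
open MeasureTheory Real RealInnerProductSpace

/-- Fourier transform of an isotropic Gaussian on the plane. -/
lemma integral_cexp_neg_mul_sq_norm_add_inner_plane {b : ℝ} (hb : 0 < b) (c : ℂ)
    (w : EuclideanSpace ℝ (Fin 2)) :
    ∫ v : EuclideanSpace ℝ (Fin 2), Complex.exp (-(b : ℂ) * ‖v‖ ^ 2 + c * ⟪w, v⟫) =
      (π / b : ℂ) * Complex.exp (c ^ 2 * ‖w‖ ^ 2 / (4 * b)) := by
  rw [GaussianFourier.integral_cexp_neg_mul_sq_norm_add (b := (b : ℂ)) (by simpa using hb) c w]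
  simp

/-- Mass of an isotropic Gaussian on the plane. -/
lemma integral_rexp_neg_mul_sq_norm_plane {b : ℝ} (hb : 0 < b) :
    ∫ v : EuclideanSpace ℝ (Fin 2), Real.exp (-b * ‖v‖ ^ 2) = π / b := by
  rw [GaussianFourier.integral_rexp_neg_mul_sq_norm hb]
  simp

/-- with
H(L,ξ,ζ) = (1/(4πDL)) exp(−iL(ξ·ζ)/(2k₀) − DL³|ζ|²/(12k₀²) − |ξ|²/(4DL))
and φ_{1/ℓ_s}(ζ) = (ℓ_s²/(2π)) exp(−ℓ_s²|ζ|²/2), one has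
∫∫ H(L,ξ,ζ) φ_{1/ℓ_s}(ζ) dξ dζ = 1/(1 + 2DL³/(3k₀²ℓ_s²)); in particular,
with D = c₂(1−g)σ_m²k₀²/(2ℓ_m) the integral equals
1/(1 + c₂(1−g)σ_m²L³/(3ℓ_m ℓ_s²)). -/
theorem relative_intensity_covariance_spot_dancing
    (D L k₀ ℓs : ℝ) (hD : 0 < D) (hL : 0 < L) (hk : 0 < k₀) (hℓs : 0 < ℓs)
    (H : ℝ → EuclideanSpace ℝ (Fin 2) → EuclideanSpace ℝ (Fin 2) → ℂ)
    (hH : ∀ (z : ℝ) (ξ ζ : EuclideanSpace ℝ (Fin 2)),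
      H z ξ ζ = (((1 / (4 * Real.pi * D * z)) : ℝ) : ℂ) *
        Complex.exp ( -Complex.I * (z : ℂ) * ((⟪ξ, ζ⟫ : ℝ) : ℂ) / (2 * (k₀ : ℂ))
          - (((D * z^3 * ‖ζ‖^2 / (12 * k₀^2)) : ℝ) : ℂ)
          - (((‖ξ‖^2 / (4 * D * z)) : ℝ) : ℂ))) :
    ((∫ ζ : EuclideanSpace ℝ (Fin 2), ∫ ξ : EuclideanSpace ℝ (Fin 2),
        H L ξ ζ * (((ℓs^2 / (2 * Real.pi)) * Real.exp (-(ℓs^2 * ‖ζ‖^2) / 2) : ℝ) : ℂ))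
      = (((1 / (1 + 2 * D * L^3 / (3 * k₀^2 * ℓs^2))) : ℝ) : ℂ))
    ∧ (∀ c₂ σm ℓm g : ℝ, 0 < c₂ → 0 < σm → 0 < ℓm →
        D = c₂ * (1 - g) * σm^2 * k₀^2 / (2 * ℓm) →
        (∫ ζ : EuclideanSpace ℝ (Fin 2), ∫ ξ : EuclideanSpace ℝ (Fin 2),
          H L ξ ζ * (((ℓs^2 / (2 * Real.pi)) * Real.exp (-(ℓs^2 * ‖ζ‖^2) / 2) : ℝ) : ℂ))
        = (((1 / (1 + c₂ * (1 - g) * σm^2 * L^3 / (3 * ℓm * ℓs^2))) : ℝ) : ℂ)) := by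
  have hinner : ∀ ζ : EuclideanSpace ℝ (Fin 2),
      ∫ ξ : EuclideanSpace ℝ (Fin 2),
        H L ξ ζ * (((ℓs^2 / (2 * Real.pi)) * Real.exp (-(ℓs^2 * ‖ζ‖^2) / 2) : ℝ) : ℂ) =
      ((ℓs ^ 2 / (2 * π) *
        Real.exp (-(D * L ^ 3 / (3 * k₀ ^ 2) + ℓs ^ 2 / 2) * ‖ζ‖ ^ 2) : ℝ) : ℂ) := by
    intro ζ
    have hb : 0 < 1 / (4 * D * L) := by positivity
    have hsplit : ∀ ξ : EuclideanSpace ℝ (Fin 2),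
        H L ξ ζ * (((ℓs^2 / (2 * Real.pi)) * Real.exp (-(ℓs^2 * ‖ζ‖^2) / 2) : ℝ) : ℂ) =
        ((1 / (4 * π * D * L) * (ℓs ^ 2 / (2 * π)) : ℝ) : ℂ) *
          Complex.exp (-(D * L ^ 3 * ‖ζ‖ ^ 2 / (12 * k₀ ^ 2) + ℓs ^ 2 * ‖ζ‖ ^ 2 / 2 : ℝ)) *
          Complex.exp (-((1 / (4 * D * L) : ℝ) : ℂ) * ‖ξ‖ ^ 2
            + (-Complex.I * L / (2 * k₀)) * ⟪ζ, ξ⟫) := by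
      intro ξ
      rw [hH, mul_assoc _ (Complex.exp _) (Complex.exp _), ← Complex.exp_add,
        real_inner_comm ζ ξ]
      push_cast
      rw [mul_mul_mul_comm, ← Complex.exp_add]
      congr 2
      ring
    simp_rw [hsplit]
    rw [integral_const_mul, integral_cexp_neg_mul_sq_norm_add_inner_plane hb, mul_mul_mul_comm,
      ← Complex.exp_add]
    push_cast
    congr 1
    · have : (D : ℂ) ≠ 0 := by exact_mod_cast hD.ne'
      have : (L : ℂ) ≠ 0 := by exact_mod_cast hL.ne'
      have : (π : ℂ) ≠ 0 := by exact_mod_cast pi_ne_zero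
      field_simp
    · congr 1
      have : (D : ℂ) ≠ 0 := by exact_mod_cast hD.ne'
      have : (L : ℂ) ≠ 0 := by exact_mod_cast hL.ne'
      have : (k₀ : ℂ) ≠ 0 := by exact_mod_cast hk.ne'
      field_simp
      rw [Complex.I_sq]
      ring
  have hmain : (∫ ζ : EuclideanSpace ℝ (Fin 2), ∫ ξ : EuclideanSpace ℝ (Fin 2),
        H L ξ ζ * (((ℓs^2 / (2 * Real.pi)) * Real.exp (-(ℓs^2 * ‖ζ‖^2) / 2) : ℝ) : ℂ))
      = (((1 / (1 + 2 * D * L^3 / (3 * k₀^2 * ℓs^2))) : ℝ) : ℂ) := by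
    simp_rw [hinner]
    rw [integral_complex_ofReal, integral_const_mul,
      integral_rexp_neg_mul_sq_norm_plane (by positivity)]
    congr 1
    field_simp
    ring
  refine ⟨hmain, fun c₂ σm ℓm g _ _ hℓm hDeq => ?_⟩
  rw [hmain, show 2 * D * L ^ 3 / (3 * k₀ ^ 2 * ℓs ^ 2) =
    c₂ * (1 - g) * σm ^ 2 * L ^ 3 / (3 * ℓm * ℓs ^ 2) by rw [hDeq]; field_simp]
end

section
/- Let C : ℝ² → ℝ be continuous with C(χ) ≤ 1 for all χ and C(χ) = 1 − c₂|χ|² + o(|χ|²) as χ → 0, with c₂ > 0. Let (α_n) and (a_n) be sequences of positive reals with α_n → ∞ and α_n c₂ a_n²/3 → γ for some γ ≥ 0. Then Q_n := e^{−α_n} · (1/(2π)) ∫_{ℝ²} e^{−|s|²/2} [ exp( α_n ∫₀¹ C(a_n s s') ds' ) − 1 ] ds converges to 1/(1 + 2γ) as n → ∞. -/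
open MeasureTheory Filter Topology

section GaussianWeight

lemma integral_exp_neg_mul_sq_norm_euclideanPlane {b : ℝ} (hb : 0 < b) :
    ∫ s : EuclideanSpace ℝ (Fin 2), Real.exp (-b * ‖s‖ ^ 2) = Real.pi / b := by
  rw [GaussianFourier.integral_rexp_neg_mul_sq_norm (V := EuclideanSpace ℝ (Fin 2)) hb]
  simp

lemma integrable_exp_neg_mul_sq_norm_euclideanPlane {b : ℝ} (hb : 0 < b) :
    Integrable fun s : EuclideanSpace ℝ (Fin 2) => Real.exp (-b * ‖s‖ ^ 2) := by
  refine not_not.1 fun h => (div_pos Real.pi_pos hb).ne' ?_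
  rw [← integral_exp_neg_mul_sq_norm_euclideanPlane hb, integral_undef h]

end GaussianWeight

section RadialAverage

variable {E : Type*} [NormedAddCommGroup E] [NormedSpace ℝ E]

/-- A quadratic expansion at the origin, given by a limit along the punctured neighbourhood,
holds as a little-o statement on the full neighbourhood for a continuous function. -/
lemma isLittleO_of_tendsto_div_sq_norm [Nontrivial E] {C : E → ℝ} {c : ℝ} (hC : Continuous C)
    (h : Tendsto (fun x => (1 - C x - c * ‖x‖ ^ 2) / ‖x‖ ^ 2) (𝓝[≠] 0) (𝓝 0)) :
    (fun x => 1 - C x - c * ‖x‖ ^ 2) =o[𝓝 0] fun x => ‖x‖ ^ 2 := by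
  have hne : ∀ᶠ x : E in 𝓝[≠] 0, ‖x‖ ^ 2 = 0 → 1 - C x - c * ‖x‖ ^ 2 = 0 := by
    filter_upwards [self_mem_nhdsWithin] with x hx h0
    exact absurd (by simpa using h0) hx
  have ho := (Asymptotics.isLittleO_iff_tendsto' hne).2 h
  have : (𝓝[≠] (0 : E)).NeBot := Module.punctured_nhds_neBot ℝ E 0
  have hcont : Continuous fun x : E => 1 - C x - c * ‖x‖ ^ 2 := by fun_prop
  have hsq : Tendsto (fun x : E => ‖x‖ ^ 2) (𝓝[≠] 0) (𝓝 0) := by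
    have : Continuous fun x : E => ‖x‖ ^ 2 := by fun_prop
    simpa using (this.tendsto 0).mono_left nhdsWithin_le_nhds
  have hzero : 1 - C 0 - c * ‖(0 : E)‖ ^ 2 = 0 :=
    tendsto_nhds_unique ((hcont.tendsto 0).mono_left nhdsWithin_le_nhds)
      (ho.isBigO.trans_tendsto hsq)
  rw [← nhdsNE_sup_pure]
  exact ho.sup (Asymptotics.isLittleO_pure.2 hzero)

/-- Averaging a function that is `o(‖x‖²)` at the origin along the segment `[0, t • s]` gives
`o(t²)`. -/
lemma isLittleO_integral_smul {f : E → ℝ} (hf : f =o[𝓝 0] fun x => ‖x‖ ^ 2) (s : E) :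
    (fun t : ℝ => ∫ u in (0 : ℝ)..1, f ((t * u) • s)) =o[𝓝 0] fun t => t ^ 2 := by
  have key : (fun t : ℝ => ∫ u in (0 : ℝ)..1, f ((t * u) • s)) =o[𝓝 0]
      fun t => t ^ 2 * (‖s‖ ^ 2 + 1) := by
    refine Asymptotics.isLittleO_iff.2 fun ε hε => ?_
    obtain ⟨δ, hδ, hball⟩ := Metric.eventually_nhds_iff_ball.1 (hf.def hε)
    have hsmall : ∀ᶠ t : ℝ in 𝓝 0, |t| * ‖s‖ < δ := by
      have hcont : Continuous fun t : ℝ => |t| * ‖s‖ := by fun_prop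
      exact (hcont.tendsto 0).eventually_lt_const (by simpa using hδ)
    filter_upwards [hsmall] with t ht
    have hbound : ∀ u ∈ Set.uIoc (0 : ℝ) 1, ‖f ((t * u) • s)‖ ≤ ε * (t ^ 2 * ‖s‖ ^ 2) := by
      intro u hu
      rw [Set.uIoc_of_le zero_le_one] at hu
      have hle : ‖(t * u) • s‖ ≤ |t| * ‖s‖ := by
        rw [norm_smul, Real.norm_eq_abs, abs_mul, abs_of_pos hu.1]
        gcongr
        exact mul_le_of_le_one_right (abs_nonneg t) hu.2
      refine (hball _ (by simpa using hle.trans_lt ht)).trans ?_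
      rw [norm_pow, norm_norm, ← sq_abs t, ← mul_pow]
      gcongr
    refine (intervalIntegral.norm_integral_le_of_norm_le_const hbound).trans ?_
    rw [Real.norm_of_nonneg (by positivity)]
    simp only [sub_zero, abs_one, mul_one]
    gcongr
    linarith
  simpa only [mul_comm _ (‖s‖ ^ 2 + 1)] using
    (Asymptotics.isLittleO_const_mul_right_iff (by positivity : ‖s‖ ^ 2 + 1 ≠ 0)).1
      (by simpa only [mul_comm _ (‖s‖ ^ 2 + 1)] using key)

/-- If `a → 0` with `α c a² / 3 → γ`, the scaled defect of the segment average of `C` tends to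
`γ ‖s‖²`. -/
lemma tendsto_mul_one_sub_integral_smul {ι : Type*} {l : Filter ι} {C : E → ℝ} {c γ : ℝ}
    (hc : c ≠ 0) (hC : Continuous C)
    (hexp : (fun x => 1 - C x - c * ‖x‖ ^ 2) =o[𝓝 0] fun x => ‖x‖ ^ 2) {α a : ι → ℝ}
    (ha : Tendsto a l (𝓝 0)) (hγ : Tendsto (fun n => α n * c * a n ^ 2 / 3) l (𝓝 γ)) (s : E) :
    Tendsto (fun n => α n * (1 - ∫ u in (0 : ℝ)..1, C ((a n * u) • s))) l
      (𝓝 (γ * ‖s‖ ^ 2)) := by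
  have hsplit : ∀ t : ℝ, (1 - ∫ u in (0 : ℝ)..1, C ((t * u) • s)) =
      (∫ u in (0 : ℝ)..1, (1 - C ((t * u) • s) - c * ‖(t * u) • s‖ ^ 2)) +
        c * t ^ 2 / 3 * ‖s‖ ^ 2 := by
    intro t
    have hquad : ∫ u in (0 : ℝ)..1, c * ‖(t * u) • s‖ ^ 2 = c * t ^ 2 / 3 * ‖s‖ ^ 2 := by
      have : ∀ u : ℝ, c * ‖(t * u) • s‖ ^ 2 = c * t ^ 2 * ‖s‖ ^ 2 * u ^ 2 := by
        intro u
        rw [norm_smul, mul_pow, Real.norm_eq_abs, sq_abs]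
        ring
      simp only [this, intervalIntegral.integral_const_mul, integral_pow]
      norm_num
      ring
    rw [intervalIntegral.integral_sub, intervalIntegral.integral_sub, hquad]
    · simp
    all_goals exact Continuous.intervalIntegrable (by fun_prop) _ _
  have hαa : Tendsto (fun n => α n * a n ^ 2) l (𝓝 (3 / c * γ)) := by
    refine (hγ.const_mul (3 / c)).congr fun n => ?_
    field_simp
  have hrem : Tendsto (fun n => α n *
      ∫ u in (0 : ℝ)..1, (1 - C ((a n * u) • s) - c * ‖(a n * u) • s‖ ^ 2)) l (𝓝 0) := by
    have ho := (Asymptotics.isBigO_refl α l).mul_isLittleO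
      ((isLittleO_integral_smul hexp s).comp_tendsto ha)
    exact (Asymptotics.isLittleO_one_iff ℝ).1 (ho.trans_isBigO (hαa.isBigO_one ℝ))
  refine (by simpa using hrem.add (hγ.mul_const (‖s‖ ^ 2)) : Tendsto _ l _).congr fun n => ?_
  rw [hsplit]
  ring

end RadialAverage

/-- strongly scattering asymptotics of the effective scattering
kernel: if C ≤ 1, C(χ) = 1 − c₂|χ|² + o(|χ|²), α_n → ∞ and α_n c₂ a_n²/3 → γ,
then Q_n = e^{−α_n}(1/(2π))∫ e^{−|s|²/2}[exp(α_n ∫₀¹ C(a_n s s')ds') − 1] ds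
converges to 1/(1+2γ). -/
theorem effective_scattering_kernel_strong_scattering_limit
    (c₂ γ : ℝ) (hc₂ : 0 < c₂) (hγ : 0 ≤ γ)
    (C : EuclideanSpace ℝ (Fin 2) → ℝ)
    (hCcont : Continuous C) (hCbd : ∀ χ, C χ ≤ 1)
    (hCexp : Tendsto
      (fun χ : EuclideanSpace ℝ (Fin 2) => (1 - C χ - c₂ * ‖χ‖^2) / ‖χ‖^2)
      (𝓝[≠] 0) (𝓝 0))
    (α a : ℕ → ℝ) (hαpos : ∀ n, 0 < α n) (hapos : ∀ n, 0 < a n)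
    (hαtop : Tendsto α atTop atTop)
    (hγlim : Tendsto (fun n => α n * c₂ * (a n)^2 / 3) atTop (𝓝 γ)) :
    Tendsto (fun n =>
        Real.exp (-(α n)) * (1 / (2 * Real.pi)) *
          ∫ s : EuclideanSpace ℝ (Fin 2), Real.exp (-‖s‖^2 / 2) *
            (Real.exp ((α n) * ∫ s' in (0:ℝ)..1, C ((a n * s') • s)) - 1))
      atTop (𝓝 (1 / (1 + 2 * γ))) := by
  have hb : (0 : ℝ) < 1 / 2 + γ := by positivity
  have ha : Tendsto a atTop (𝓝 0) := by
    have hsq : Tendsto (fun n => a n ^ 2) atTop (𝓝 0) := by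
      have h := (hγlim.const_mul (3 / c₂)).mul hαtop.inv_tendsto_atTop
      rw [mul_zero] at h
      refine h.congr fun n => ?_
      have := (hαpos n).ne'
      simp only [Pi.inv_apply]
      field_simp
    have h := hsq.sqrt
    rw [Real.sqrt_zero] at h
    exact h.congr fun n => Real.sqrt_sq (hapos n).le
  set I : ℕ → EuclideanSpace ℝ (Fin 2) → ℝ :=
    fun n s => ∫ u in (0 : ℝ)..1, C ((a n * u) • s)
  have hIcont : ∀ n, Continuous (I n) := fun n =>
    intervalIntegral.continuous_parametric_intervalIntegral_of_continuous' (by fun_prop) _ _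
  have hIle : ∀ n s, I n s ≤ 1 := fun n s => by
    have h := intervalIntegral.integral_mono_on zero_le_one
      (Continuous.intervalIntegrable (by fun_prop) _ _)
      (intervalIntegrable_const (μ := volume)) fun u (_ : u ∈ Set.Icc (0 : ℝ) 1) => hCbd ((a n * u) • s)
    simpa using h
  have hpt : ∀ s, Tendsto (fun n => Real.exp (-(1 / 2) * ‖s‖ ^ 2) *
      (Real.exp (-(α n * (1 - I n s))) - Real.exp (-α n))) atTop
      (𝓝 (Real.exp (-(1 / 2 + γ) * ‖s‖ ^ 2))) := by
    intro s
    have h := tendsto_mul_one_sub_integral_smul hc₂.ne' hCcont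
      (isLittleO_of_tendsto_div_sq_norm hCcont hCexp) ha hγlim s
    have h' := (((Real.continuous_exp.tendsto _).comp h.neg).sub
      (Real.tendsto_exp_neg_atTop_nhds_zero.comp hαtop)).const_mul (Real.exp (-(1 / 2) * ‖s‖ ^ 2))
    rw [sub_zero, ← Real.exp_add] at h'
    rwa [show -(1 / 2 + γ) * ‖s‖ ^ 2 = -(1 / 2) * ‖s‖ ^ 2 + -(γ * ‖s‖ ^ 2) by ring]
  have hlim := tendsto_integral_of_dominated_convergence (μ := volume) _
    (fun n => Continuous.aestronglyMeasurable (by have := hIcont n; fun_prop))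
    (integrable_exp_neg_mul_sq_norm_euclideanPlane one_half_pos)
    (fun n => ae_of_all _ fun s => by
      rw [norm_mul, Real.norm_of_nonneg (Real.exp_pos _).le]
      refine mul_le_of_le_one_right (Real.exp_pos _).le ?_
      have h₁ : Real.exp (-(α n * (1 - I n s))) ≤ 1 := Real.exp_le_one_iff.2 <|
        neg_nonpos.2 <| mul_nonneg (hαpos n).le (sub_nonneg.2 (hIle n s))
      have h₂ : Real.exp (-α n) ≤ 1 := Real.exp_le_one_iff.2 (neg_nonpos.2 (hαpos n).le)
      rw [Real.norm_eq_abs, abs_le]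
      constructor <;> linarith [Real.exp_pos (-(α n * (1 - I n s))), Real.exp_pos (-α n)])
    (ae_of_all _ hpt)
  rw [integral_exp_neg_mul_sq_norm_euclideanPlane hb] at hlim
  have hval : 1 / (1 + 2 * γ) = 1 / (2 * Real.pi) * (Real.pi / (1 / 2 + γ)) := by
    have := Real.pi_pos.ne'
    have : 1 + 2 * γ ≠ 0 := by positivity
    field_simp
  rw [hval]
  refine (hlim.const_mul (1 / (2 * Real.pi))).congr fun n => ?_
  rw [mul_comm (Real.exp _) (1 / _), mul_assoc, ← integral_const_mul (Real.exp _)]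
  congr 2
  funext s
  rw [show -(α n * (1 - I n s)) = -α n + α n * I n s by ring, Real.exp_add,
    show -(1 / 2) * ‖s‖ ^ 2 = -‖s‖ ^ 2 / 2 by ring]
  ring
end
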